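/- Let r ∈ ℝ^d with r_0 ≠ 0 be such that the companion matrix M_r is contractive with respect to a norm ‖·‖ satisfying ‖M_r x‖ ≤ ρ̃‖x‖ for some ρ̃ < 1 and all x ∈ ℝ^d. Then for every x ∈ ℤ^d, every n ∈ ℕ, and every z ∈ τ_r^{-n}(x), one has ‖M_r^n z - x‖ ≤ R, where R = Σ_{k=0}^∞ ‖M_r^k (0,...,0,1)^t‖ ≤ ‖(0,...,0,1)^t‖/(1-ρ̃). -/

import Mathlib

open Matrix Filter

noncomputable section

/-- Scalar product r·z of a real vector with an integer vector. -/
def srsDot {d : ℕ} (r : Fin d → ℝ) (z : Fin d → ℤ) : ℝ := ∑ i, r i * (z i : ℝ)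

/-- The shift radix map τ_r(z) = (z_1,...,z_{d-1}, -⌊r·z⌋). -/
def srsTau {d : ℕ} (r : Fin d → ℝ) (z : Fin d → ℤ) : Fin d → ℤ :=
  fun i => if h : (i : ℕ) + 1 < d then z ⟨(i : ℕ) + 1, h⟩ else -⌊srsDot r z⌋

/-- The companion matrix M_r of r. -/
def companion {d : ℕ} (r : Fin d → ℝ) : Matrix (Fin d) (Fin d) ℝ :=
  fun i j => if (i : ℕ) + 1 < d then (if (j : ℕ) = (i : ℕ) + 1 then 1 else 0) else -r j

/-- The vector (0,...,0,v)^t. -/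
def digitVec {d : ℕ} (v : ℝ) : Fin d → ℝ := fun i => if (i : ℕ) + 1 = d then v else 0

/-- Coordinatewise cast of an integer vector to a real vector. -/
def intToReal {d : ℕ} (z : Fin d → ℤ) : Fin d → ℝ := fun i => (z i : ℝ)

/-- M_r is contractive (spectral radius < 1). -/
def srsContractive {d : ℕ} (r : Fin d → ℝ) : Prop :=
  ∃ C > (0:ℝ), ∃ ρ : ℝ, 0 ≤ ρ ∧ ρ < 1 ∧
    ∀ (n : ℕ) (x : Fin d → ℝ), ‖((companion r) ^ n).mulVec x‖ ≤ C * ρ ^ n * ‖x‖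

/-- The SRS tile T_r(x), as the set of limit points lim M_r^n z_{-n} with
τ_r^n(z_{-n}) = x. -/
def srsTile {d : ℕ} (r : Fin d → ℝ) (x : Fin d → ℤ) : Set (Fin d → ℝ) :=
  {t | ∃ z : ℕ → (Fin d → ℤ), (∀ n, (srsTau r)^[n] (z n) = x) ∧
    Tendsto (fun n => ((companion r) ^ n).mulVec (intToReal (z n))) atTop (nhds t)}

/-- One step of `τ_r` differs from `M_r` by a fractional part in the last coordinate. -/
lemma companion_mulVec_intToReal {d : ℕ} (r : Fin d → ℝ) (z : Fin d → ℤ) :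
    (companion r).mulVec (intToReal z) =
      (-Int.fract (srsDot r z)) • digitVec 1 + intToReal (srsTau r z) := by
  ext i
  by_cases h : (i : ℕ) + 1 < d
  · have hj (j : Fin d) : (j : ℕ) = (i : ℕ) + 1 ↔ j = ⟨(i : ℕ) + 1, h⟩ := by
      rw [Fin.ext_iff]
    simp [Matrix.mulVec, dotProduct, companion, digitVec, intToReal, srsTau, h, h.ne, hj]
  · have hi : (i : ℕ) + 1 = d := by omega
    have hdot : (companion r).mulVec (intToReal z) i = -srsDot r z := by
      simp [Matrix.mulVec, dotProduct, companion, intToReal, srsDot, h]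
    rw [hdot]
    simp only [Pi.add_apply, Pi.smul_apply, digitVec, hi, if_true, intToReal, srsTau,
      dif_neg, not_false_eq_true, smul_eq_mul, Int.cast_neg, lt_self_iff_false]
    linarith [Int.floor_add_fract (srsDot r z)]

lemma norm_companion_pow_mulVec_sub_iterate_le {d : ℕ} (r : Fin d → ℝ)
    (Nm : (Fin d → ℝ) → ℝ)
    (hadd : ∀ x y, Nm (x + y) ≤ Nm x + Nm y)
    (hsmul : ∀ (c : ℝ) x, Nm (c • x) = |c| * Nm x)
    (hpos : ∀ x, 0 ≤ Nm x) (n : ℕ) (z : Fin d → ℤ) :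
    Nm (((companion r) ^ n).mulVec (intToReal z) - intToReal ((srsTau r)^[n] z)) ≤
      ∑ k ∈ Finset.range n, Nm (((companion r) ^ k).mulVec (digitVec 1)) := by
  induction n generalizing z with
  | zero =>
    have h0 : Nm 0 = 0 := by simpa using hsmul 0 0
    simp [h0]
  | succ n ih =>
    rw [pow_succ, ← Matrix.mulVec_mulVec, companion_mulVec_intToReal, Matrix.mulVec_add,
      Matrix.mulVec_smul, Function.iterate_succ_apply, Finset.sum_range_succ, add_sub_assoc,
      add_comm (Finset.sum _ _)]
    refine (hadd _ _).trans (add_le_add ?_ (ih _))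
    rw [hsmul, abs_neg, abs_of_nonneg (Int.fract_nonneg _)]
    exact mul_le_of_le_one_left (hpos _) (Int.fract_lt_one _).le

lemma norm_pow_mulVec_le {d : ℕ} (M : Matrix (Fin d) (Fin d) ℝ)
    (Nm : (Fin d → ℝ) → ℝ) (ρ : ℝ) (hρ0 : 0 ≤ ρ)
    (hcontr : ∀ x, Nm (M.mulVec x) ≤ ρ * Nm x) (k : ℕ) (v : Fin d → ℝ) :
    Nm ((M ^ k).mulVec v) ≤ ρ ^ k * Nm v := by
  induction k with
  | zero => simp
  | succ k ih =>
    rw [pow_succ', ← Matrix.mulVec_mulVec, pow_succ', mul_assoc]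
    exact (hcontr _).trans (mul_le_mul_of_nonneg_left ih hρ0)

/-- for a norm Nm with Nm(M_r x) ≤ ρ̃ Nm(x), ρ̃ < 1, every z with
τ_r^n(z) = x satisfies Nm(M_r^n z - x) ≤ R = Σ_k Nm(M_r^k(0,…,0,1)^t), and
R ≤ Nm((0,…,0,1)^t)/(1-ρ̃). -/
theorem srs_preimage_norm_bound (d : ℕ) (hd : 0 < d) (r : Fin d → ℝ)
    (hr0 : r ⟨0, hd⟩ ≠ 0)
    (Nm : (Fin d → ℝ) → ℝ) (ρ : ℝ) (hρ0 : 0 ≤ ρ) (hρ : ρ < 1)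
    (hadd : ∀ x y, Nm (x + y) ≤ Nm x + Nm y)
    (hsmul : ∀ (c : ℝ) x, Nm (c • x) = |c| * Nm x)
    (hpos : ∀ x, 0 ≤ Nm x)
    (hdef : ∀ x, Nm x = 0 → x = 0)
    (hcontr : ∀ x, Nm ((companion r).mulVec x) ≤ ρ * Nm x)
    (x : Fin d → ℤ) (n : ℕ) (z : Fin d → ℤ) (hz : (srsTau r)^[n] z = x) :
    Nm (((companion r) ^ n).mulVec (intToReal z) - intToReal x) ≤
        ∑' k : ℕ, Nm (((companion r) ^ k).mulVec (digitVec 1)) ∧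
      ∑' k : ℕ, Nm (((companion r) ^ k).mulVec (digitVec 1)) ≤
        Nm (digitVec 1) / (1 - ρ) := by
  have hle (k : ℕ) := norm_pow_mulVec_le (companion r) Nm ρ hρ0 hcontr k (digitVec 1)
  have hgeom : HasSum (fun k : ℕ => ρ ^ k * Nm (digitVec 1)) ((1 - ρ)⁻¹ * Nm (digitVec 1)) :=
    (hasSum_geometric_of_lt_one hρ0 hρ).mul_right _
  have hsum : Summable fun k : ℕ => Nm (((companion r) ^ k).mulVec (digitVec 1)) :=
    hgeom.summable.of_nonneg_of_le (fun _ => hpos _) hle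
  constructor
  · rw [← hz]
    exact (norm_companion_pow_mulVec_sub_iterate_le r Nm hadd hsmul hpos n z).trans
      (hsum.sum_le_tsum _ fun _ _ => hpos _)
  · rw [div_eq_inv_mul, ← hgeom.tsum_eq]
    exact hsum.tsum_le_tsum hle hgeom.summable
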